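/- arXiv:2109.08706 — 4 statements merged into one kernel-verified Lean document; each statement's English description precedes it below -/
import Mathlib

section
/- In a two-arc parallel network with identical users, the greedy algorithm A satisfies N_{1,A}(I) ≥ N'_1 for every input sequence I and every feasible assignment x' with arc counts N'_1, N'_2, where N_{1,A}(I) is the number of users greedy assigns to arc 1 (the arc with the lower travel time t_1 ≤ t_2). -/
open Finset

noncomputable section
open scoped Classical

/-- Number of users (under assignment `x`) occupying arc `a` at time `s`:
a user `j` assigned to arc `a` occupies it during `[τ j, τ j + t a]`. -/
def load {M n : ℕ} (t : Fin M → ℝ) (τ : Fin n → ℝ) (x : Fin n → Fin M)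
    (a : Fin M) (s : ℝ) : ℕ :=
  (Finset.univ.filter fun j : Fin n => x j = a ∧ τ j ≤ s ∧ s ≤ τ j + t a).card

/-- An assignment is feasible if at every arrival time every arc is within capacity. -/
def Feasible {M n : ℕ} (t : Fin M → ℝ) (c : Fin M → ℕ) (τ : Fin n → ℝ)
    (x : Fin n → Fin M) : Prop :=
  ∀ (a : Fin M) (k : Fin n), load t τ x a (τ k) ≤ c a

/-- Total value-of-time weighted travel cost of an assignment. -/
def cost {M n : ℕ} (t : Fin M → ℝ) (θ : Fin n → ℝ) (x : Fin n → Fin M) : ℝ :=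
  ∑ i, θ i * t (x i)

/-- Optimal offline cost. -/
def OPT {M n : ℕ} (t : Fin M → ℝ) (c : Fin M → ℕ) (τ θ : Fin n → ℝ) : ℝ :=
  sInf {C : ℝ | ∃ x : Fin n → Fin M, Feasible t c τ x ∧ cost t θ x = C}

/-- Valid arrival sequence: strictly increasing arrival times, first arrival at time 0. -/
def ValidSeq {n : ℕ} (τ : Fin n → ℝ) : Prop :=
  StrictMono τ ∧ ∀ i : Fin n, (i : ℕ) = 0 → τ i = 0

/-- The instance admits some feasible assignment. -/
def FeasibleInstance {M n : ℕ} (t : Fin M → ℝ) (c : Fin M → ℕ) (τ : Fin n → ℝ) : Prop :=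
  ∃ x : Fin n → Fin M, Feasible t c τ x

/-- The history `(τ_1, θ_1), …, (τ_i, θ_i)` visible to an online algorithm
when user `i` arrives. -/
def hist {n : ℕ} (τ θ : Fin n → ℝ) (i : Fin n) : List (ℝ × ℝ) :=
  List.ofFn fun j : Fin ((i : ℕ) + 1) =>
    (τ ⟨j, lt_of_le_of_lt (Nat.lt_succ_iff.mp j.isLt) i.isLt⟩,
     θ ⟨j, lt_of_le_of_lt (Nat.lt_succ_iff.mp j.isLt) i.isLt⟩)

/-- Assignment produced by a deterministic online algorithm `A`:
the arc of user `i` only depends on the history up to and including `i`. -/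
def algAssign {M n : ℕ} (A : List (ℝ × ℝ) → Fin M) (τ θ : Fin n → ℝ) :
    Fin n → Fin M :=
  fun i => A (hist τ θ i)

/-- A deterministic online algorithm is feasible if it produces a feasible
assignment on every valid input sequence (admitting a feasible assignment). -/
def FeasibleAlg {M : ℕ} (t : Fin M → ℝ) (c : Fin M → ℕ)
    (A : List (ℝ × ℝ) → Fin M) : Prop :=
  ∀ (n : ℕ) (τ θ : Fin n → ℝ), ValidSeq τ → (∀ i, 0 < θ i) →
    FeasibleInstance t c τ → Feasible t c τ (algAssign A τ θ)

/-- Number of users already occupying arc `a` when user `i` arrives. -/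
def loadBefore {M n : ℕ} (t : Fin M → ℝ) (τ : Fin n → ℝ) (x : Fin n → Fin M)
    (a : Fin M) (i : Fin n) : ℕ :=
  (Finset.univ.filter fun j : Fin n => j < i ∧ x j = a ∧ τ j ≤ τ i ∧ τ i ≤ τ j + t a).card

/-- `g` is a greedy assignment: each arriving user goes to the lowest-cost arc that is
below capacity at its arrival time (arcs being ordered by nondecreasing travel time,
the lowest-cost available arc is the one of least index). -/
def IsGreedy {M n : ℕ} (t : Fin M → ℝ) (c : Fin M → ℕ) (τ : Fin n → ℝ)
    (g : Fin n → Fin M) : Prop :=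
  ∀ i : Fin n, (∃ a, loadBefore t τ g a i < c a) →
    IsLeast {a : Fin M | loadBefore t τ g a i < c a} (g i)

/-- Number of users assigned to arc `a`. -/
def arcCount {M n : ℕ} (x : Fin n → Fin M) (a : Fin M) : ℕ :=
  (Finset.univ.filter fun i => x i = a).card

end

/-- When a greedy assignment does not send user `i` to arc `0`, that arc is at capacity. -/
theorem IsGreedy.le_loadBefore_zero {M n : ℕ} [NeZero M] {t : Fin M → ℝ} {c : Fin M → ℕ}
    {τ : Fin n → ℝ} {g : Fin n → Fin M} (hg : IsGreedy t c τ g) {i : Fin n} (hi : g i ≠ 0) :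
    c 0 ≤ loadBefore t τ g 0 i := by
  by_contra! h
  exact hi (le_antisymm ((hg i ⟨0, h⟩).2 h) (Fin.zero_le _))

/-- On every initial segment of users, a greedy assignment puts at least as many users on
arc `0` as any feasible assignment. -/
theorem IsGreedy.card_filter_eq_zero_le {M n : ℕ} [NeZero M] {t : Fin M → ℝ} {c : Fin M → ℕ}
    {τ : Fin n → ℝ} {g x : Fin n → Fin M} (hg : IsGreedy t c τ g) (hτ : Monotone τ)
    (ht : 0 ≤ t 0) (hx : Feasible t c τ x) (S : Finset (Fin n))
    (hS : IsLowerSet (S : Set (Fin n))) :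
    (S.filter fun j => x j = 0).card ≤ (S.filter fun j => g j = 0).card := by
  induction S using Finset.strongInduction with
  | H S ih =>
  rcases S.eq_empty_or_nonempty with rfl | hne
  · simp
  have hiS := S.max'_mem hne
  have hmax : ∀ j ∈ S, j ≤ S.max' hne := fun j hj => S.le_max' j hj
  generalize S.max' hne = i at hiS hmax
  by_cases hi : g i = 0
  · have hlow : IsLowerSet ((S.erase i : Finset (Fin n)) : Set (Fin n)) := by
      intro a b hba ha
      simp only [Finset.coe_erase, Set.mem_sdiff, Finset.mem_coe, Set.mem_singleton_iff] at ha ⊢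
      refine ⟨hS hba ha.1, ?_⟩
      rintro rfl
      exact ha.2 (le_antisymm (hmax a ha.1) hba)
    have h := ih _ (Finset.erase_ssubset hiS) hlow
    rw [← Finset.insert_erase hiS, Finset.filter_insert, Finset.filter_insert, if_pos hi,
      Finset.card_insert_of_notMem (by simp)]
    split_ifs
    · exact (Finset.card_insert_le _ _).trans (by lia)
    · lia
  · have hlow : IsLowerSet ((S.filter fun j => τ j + t 0 < τ i : Finset (Fin n)) :
        Set (Fin n)) := by
      intro a b hba ha
      simp only [Finset.coe_filter, Set.mem_ofPred_eq] at ha ⊢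
      exact ⟨hS hba ha.1, by linarith [hτ hba, ha.2]⟩
    have h := ih _ (Finset.filter_ssubset.2 ⟨i, hiS, by linarith⟩) hlow
    have split (y : Fin n → Fin M) : (S.filter fun j => y j = 0).card =
        ((S.filter fun j => τ j + t 0 < τ i).filter fun j => y j = 0).card +
          ((S.filter fun j => y j = 0).filter fun j => ¬ τ j + t 0 < τ i).card := by
      rw [Finset.filter_comm, Finset.card_filter_add_card_filter_not]
    have hxi : ((S.filter fun j => x j = 0).filter fun j => ¬ τ j + t 0 < τ i).card ≤ c 0 := by
      refine (Finset.card_le_card fun j hj => ?_).trans (hx 0 i)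
      simp only [Finset.mem_filter, Finset.mem_univ, true_and, not_lt] at hj ⊢
      exact ⟨hj.1.2, hτ (hmax j hj.1.1), hj.2⟩
    have hgi : c 0 ≤ ((S.filter fun j => g j = 0).filter fun j => ¬ τ j + t 0 < τ i).card := by
      refine (hg.le_loadBefore_zero hi).trans (Finset.card_le_card fun j hj => ?_)
      simp only [Finset.mem_filter, Finset.mem_univ, true_and, not_lt] at hj ⊢
      exact ⟨⟨hS hj.1.le hiS, hj.2.1⟩, hj.2.2.2⟩
    rw [split x, split g]
    lia

/-- Lemma 2, sufficiency for optimality of greedy for two-arc OTR-I.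
In a two-arc parallel network with identical users, a greedy assignment puts at least as
many users on arc `1` (the arc with the lower travel time) as any feasible assignment. -/
theorem stmt3_greedy_maximizes_arc_one
    (t : Fin 2 → ℝ) (c : Fin 2 → ℕ)
    (ht0 : 0 < t 0) (ht01 : t 0 ≤ t 1) (hc : ∀ a, 1 ≤ c a)
    (n : ℕ) (τ : Fin n → ℝ) (hτ : ValidSeq τ)
    (g : Fin n → Fin 2) (hg : IsGreedy t c τ g)
    (x' : Fin n → Fin 2) (hx' : Feasible t c τ x') :
    arcCount x' 0 ≤ arcCount g 0 := by
  convert hg.card_filter_eq_zero_le hτ.1.monotone ht0.le hx' Finset.univ (by simp [isLowerSet_univ])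
    using 1 <;> exact congrArg Finset.card (Finset.filter_congr_decidable ..)
end

section
/- In a two-arc parallel network with identical users, if the greedy algorithm assigns the q-th arriving user of an input sequence I to arc 2, then every feasible assignment for I must assign at least one of the first q users to arc 2. -/
open Finset

/-- A greedy user who is not sent to arc `0` finds arc `0` at capacity. -/
theorem IsGreedy.capacity_le_loadBefore {t : Fin 2 → ℝ} {c : Fin 2 → ℕ} {n : ℕ}
    {τ : Fin n → ℝ} {g : Fin n → Fin 2} (hg : IsGreedy t c τ g) {q : Fin n} (hq : g q = 1) :
    c 0 ≤ loadBefore t τ g 0 q := by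
  by_contra! h
  have hle : g q ≤ 0 := (hg q ⟨0, h⟩).2 h
  simp [hq] at hle

/-- If `x` sends every user up to `q` to arc `a`, then at the arrival of `q` the arc `a` carries
under `x`, besides `q` itself, at least the users that any assignment `g` left there. -/
theorem loadBefore_lt_load {M n : ℕ} {t : Fin M → ℝ} {τ : Fin n → ℝ} (g : Fin n → Fin M)
    {x : Fin n → Fin M} {a : Fin M} {q : Fin n} (ht : 0 ≤ t a) (hx : ∀ i ≤ q, x i = a) :
    loadBefore t τ g a q < load t τ x a (τ q) := by
  refine Finset.card_lt_card (Finset.ssubset_iff_of_subset ?_ |>.2 ⟨q, ?_, ?_⟩)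
  · intro j hj
    simp only [Finset.mem_filter, Finset.mem_univ, true_and] at hj ⊢
    exact ⟨hx j hj.1.le, hj.2.2⟩
  · simp [hx q le_rfl, ht]
  · simp

/-- base-case claim in the proof of Lemma 2.
In a two-arc parallel network with identical users and `t 0 < t 1`, if a greedy
assignment sends the `q`-th arriving user to arc `2` (index `1`), then every feasible
assignment sends at least one of the first `q` users to arc `2`. -/
theorem stmt4_greedy_arc_two_forces
    (t : Fin 2 → ℝ) (c : Fin 2 → ℕ)
    (ht0 : 0 < t 0) (ht01 : t 0 < t 1) (hc : ∀ a, 1 ≤ c a)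
    (n : ℕ) (τ : Fin n → ℝ) (hτ : ValidSeq τ)
    (g : Fin n → Fin 2) (hg : IsGreedy t c τ g)
    (q : Fin n) (hq : g q = 1)
    (x' : Fin n → Fin 2) (hx' : Feasible t c τ x') :
    ∃ i : Fin n, i ≤ q ∧ x' i = 1 := by
  by_contra! h
  have hx0 : ∀ i ≤ q, x' i = 0 := fun i hi => by
    have := h i hi
    omega
  have hlt := loadBefore_lt_load (τ := τ) g ht0.le hx0
  have hle := hg.capacity_le_loadBefore hq
  have hcap := hx' 0 q
  omega
end

section
/- For any two-arc parallel network with travel times 0 < t_1 ≤ t_2 and integer capacities c_1, c_2 ≥ 1, and any input sequence I whose users' values of time take the two values θ' ≤ θ'' (both positive), the greedy algorithm A satisfies ALG(I, A) / OPT(I) ≤ (θ'' t_2 + θ' t_1)/(θ'' t_1 + θ' t_2). Hence greedy attains the best possible worst-case ratio among all feasible deterministic online algorithms for this problem. -/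
open Finset

/-- If the fixed arc is full whenever `g` avoids it, then on every initial segment of the users
`g` sends at least as many users to that arc as any assignment respecting its capacity. -/
theorem card_filter_le_of_full {M n : ℕ} {t : Fin M → ℝ} {τ : Fin n → ℝ} {x g : Fin n → Fin M}
    {a : Fin M} {C : ℕ} (hτ : StrictMono τ) (ht : 0 ≤ t a) (hx : ∀ k, load t τ x a (τ k) ≤ C)
    (hg : ∀ i, g i ≠ a → C ≤ loadBefore t τ g a i) (L : Finset (Fin n))
    (hL : IsLowerSet (L : Set (Fin n))) :
    (L.filter fun j => x j = a).card ≤ (L.filter fun j => g j = a).card := by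
  induction L using Finset.strongInduction with
  | H L ih =>
    rcases L.eq_empty_or_nonempty with rfl | hne
    · simp
    set i := L.max' hne with hi
    have hiL : i ∈ L := L.max'_mem hne
    have hmax : ∀ j ∈ L, j ≤ i := fun j hj => L.le_max' j hj
    by_cases hgi : g i = a
    · have hlow : IsLowerSet ((L.erase i : Finset (Fin n)) : Set (Fin n)) := by
        intro p q hqp hp
        simp only [Finset.coe_erase, Set.mem_sdiff, Finset.mem_coe, Set.mem_singleton_iff] at hp ⊢
        refine ⟨hL hqp hp.1, ?_⟩
        rintro rfl
        exact hp.2 (le_antisymm (hmax p hp.1) hqp)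
      have h := ih _ (Finset.erase_ssubset hiL) hlow
      have hgc : (L.filter fun j => g j = a).card
          = ((L.erase i).filter fun j => g j = a).card + 1 := by
        rw [Finset.filter_erase, Finset.card_erase_add_one (by simp [hiL, hgi])]
      have hxc : (L.filter fun j => x j = a).card
          ≤ ((L.erase i).filter fun j => x j = a).card + 1 := by
        rw [Finset.filter_erase]
        exact Nat.le_add_of_sub_le Finset.pred_card_le_card_erase
      omega
    · set L' := L.filter fun j => τ j + t a < τ i with hL'
      have hlow : IsLowerSet (L' : Set (Fin n)) := by
        intro p q hqp hp
        simp only [hL', Finset.coe_filter, Set.mem_ofPred_eq] at hp ⊢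
        exact ⟨hL hqp hp.1, by linarith [hτ.monotone hqp]⟩
      have hfull := hg i hgi
      have hcap := hx i
      unfold loadBefore at hfull
      unfold load at hcap
      have hxc : (L.filter fun j => x j = a).card ≤ (L'.filter fun j => x j = a).card + C := by
        refine le_trans (le_trans (Finset.card_le_card ?_) (Finset.card_union_le _ _))
          (Nat.add_le_add_left hcap _)
        intro j hj
        simp only [hL', Finset.mem_filter, Finset.mem_union, Finset.mem_univ, true_and] at hj ⊢
        rcases lt_or_ge (τ j + t a) (τ i) with h | h
        · exact Or.inl ⟨⟨hj.1, h⟩, hj.2⟩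
        · exact Or.inr ⟨hj.2, hτ.monotone (hmax j hj.1), h⟩
      have hgc : (L'.filter fun j => g j = a).card + C ≤ (L.filter fun j => g j = a).card := by
        refine le_trans (Nat.add_le_add_left hfull _) ?_
        rw [← Finset.card_union_of_disjoint]
        · refine Finset.card_le_card fun j hj => ?_
          simp only [hL', Finset.mem_filter, Finset.mem_union, Finset.mem_univ, true_and] at hj ⊢
          rcases hj with h | h
          · exact ⟨h.1.1, h.2⟩
          · exact ⟨hL h.1.le hiL, h.2.1⟩
        · rw [Finset.disjoint_left]
          intro j hj hj'
          simp only [hL', Finset.mem_filter, Finset.mem_univ, true_and] at hj hj'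
          exact absurd hj.1.2 (not_lt.mpr hj'.2.2.2)
      have hss : L' ⊂ L :=
        Finset.filter_ssubset.mpr ⟨i, hiL, by linarith⟩
      have := ih L' hss hlow
      omega

/-- On two arcs, greedy avoids the first arc only when that arc is full. -/
theorem IsGreedy.le_loadBefore {n : ℕ} {t : Fin 2 → ℝ} {c : Fin 2 → ℕ} {τ : Fin n → ℝ}
    {g : Fin n → Fin 2} (hg : IsGreedy t c τ g) (i : Fin n) (hi : g i ≠ 0) :
    c 0 ≤ loadBefore t τ g 0 i := by
  by_contra! h
  exact hi (Fin.le_zero_iff.mp ((hg i ⟨0, h⟩).2 h))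

/-- An assignment using the fast arc at least as often as another one costs at most
`(θ'' t₂ + θ' t₁)/(θ'' t₁ + θ' t₂)` times as much. -/
theorem cost_le_of_arcCount_le {n : ℕ} {t : Fin 2 → ℝ} {θ' θ'' : ℝ} {θ : Fin n → ℝ}
    {x g : Fin n → Fin 2} (ht0 : 0 < t 0) (ht01 : t 0 ≤ t 1) (hθ0 : 0 < θ') (hθ : θ' ≤ θ'')
    (hθi : ∀ i, θ' ≤ θ i ∧ θ i ≤ θ'') (h : arcCount x 0 ≤ arcCount g 0) :
    cost t θ g ≤ (θ'' * t 1 + θ' * t 0) / (θ'' * t 0 + θ' * t 1) * cost t θ x := by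
  set r := (θ'' * t 1 + θ' * t 0) / (θ'' * t 0 + θ' * t 1) with hr
  have hden : 0 < θ'' * t 0 + θ' * t 1 := by nlinarith
  have hr1 : 1 ≤ r := by
    rw [hr, one_le_div hden]
    nlinarith
  have hrd : r * (θ'' * t 0 + θ' * t 1) = θ'' * t 1 + θ' * t 0 := div_mul_cancel₀ _ hden.ne'
  set l := θ' * (r * t 1 - t 0) with hl
  have hA : 0 ≤ r * t 1 - t 0 := by nlinarith
  have hl0 : 0 ≤ l := mul_nonneg hθ0.le hA
  have hl2 : l = θ'' * (t 1 - r * t 0) := by linarith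
  have hB : 0 ≤ t 1 - r * t 0 :=
    nonneg_of_mul_nonneg_right (hl2 ▸ hl0) (hθ0.trans_le hθ)
  have key : ∀ i, θ i * t (g i) - r * (θ i * t (x i))
      ≤ l * ((if x i = 0 then 1 else 0) - (if g i = 0 then 1 else 0)) := by
    intro i
    obtain ⟨h1, h2⟩ := hθi i
    have hpos : 0 < θ i := hθ0.trans_le h1
    have e1 := mul_le_mul_of_nonneg_right h1 hA
    have e2 := mul_le_mul_of_nonneg_right h2 hB
    have e3 : 0 ≤ (r - 1) * (θ i * t 0) := by
      have := sub_nonneg.mpr hr1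
      positivity
    have e4 : 0 ≤ (r - 1) * (θ i * t 1) := by
      have := sub_nonneg.mpr hr1
      have := ht0.trans_le ht01
      positivity
    obtain hgi | hgi : g i = 0 ∨ g i = 1 := by omega
    all_goals
      obtain hxi | hxi : x i = 0 ∨ x i = 1 := by omega
      all_goals
        simp only [hgi, hxi]
        norm_num
        linarith
  have hsum := Finset.sum_le_sum fun i (_ : i ∈ Finset.univ) => key i
  rw [Finset.sum_sub_distrib, ← Finset.mul_sum, ← Finset.mul_sum, Finset.sum_sub_distrib,
    Finset.sum_boole, Finset.sum_boole] at hsum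
  have hcast : ((arcCount x 0 : ℕ) : ℝ) ≤ (arcCount g 0 : ℕ) := Nat.cast_le.mpr h
  unfold arcCount at hcast
  have := mul_nonneg hl0 (sub_nonneg.mpr hcast)
  unfold cost
  linarith

/-- The optimal cost is at most the cost of any feasible assignment, and is positive as soon as
there is a user. -/
theorem OPT_le_and_pos {n : ℕ} {t : Fin 2 → ℝ} {c : Fin 2 → ℕ} {τ θ : Fin n → ℝ}
    {x : Fin n → Fin 2} (ht0 : 0 < t 0) (ht01 : t 0 ≤ t 1) (hn : 0 < n) (hθ : ∀ i, 0 < θ i)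
    (hx : Feasible t c τ x) : OPT t c τ θ ≤ cost t θ x ∧ 0 < OPT t c τ θ := by
  have hlb : ∀ C ∈ {C : ℝ | ∃ x : Fin n → Fin 2, Feasible t c τ x ∧ cost t θ x = C},
      ∑ i, θ i * t 0 ≤ C := by
    rintro _ ⟨y, -, rfl⟩
    exact Finset.sum_le_sum fun i _ => mul_le_mul_of_nonneg_left
      ((Fin.forall_fin_two (p := fun a => t 0 ≤ t a)).mpr ⟨le_rfl, ht01⟩ (y i)) (hθ i).le
  refine ⟨csInf_le ⟨_, hlb⟩ ⟨x, hx, rfl⟩, lt_of_lt_of_le ?_ (le_csInf ⟨_, x, hx, rfl⟩ hlb)⟩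
  exact Finset.sum_pos (fun i _ => mul_pos (hθ i) ht0) ⟨⟨0, hn⟩, Finset.mem_univ _⟩

/-- A unit-capacity instance is feasible under any injective assignment. -/
theorem feasible_of_injective {M n : ℕ} {t : Fin M → ℝ} {c : Fin M → ℕ} {τ : Fin n → ℝ}
    {x : Fin n → Fin M} (hc : ∀ a, 1 ≤ c a) (hx : Function.Injective x) : Feasible t c τ x := by
  intro a k
  refine le_trans (Finset.card_le_one.mpr fun p hp q hq => hx ?_) (hc a)
  simp only [Finset.mem_filter] at hp hq
  exact hp.2.1.trans hq.2.1.symm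

/-- upper-bound part of Lemma 4.
For any two-arc parallel network with travel times `0 < t 0 ≤ t 1` and integer
capacities `≥ 1`, and any input sequence whose values of time lie in `{θ', θ''}` with
`0 < θ' ≤ θ''`, every greedy assignment has cost at most
`(θ'' t₂ + θ' t₁)/(θ'' t₁ + θ' t₂)` times the optimal offline cost.  Hence greedy
attains the best possible worst-case ratio among feasible deterministic online
algorithms: every such algorithm admits (for unit capacities) an input sequence with
ratio at least this bound. -/
theorem stmt9_greedy_two_arc_nonidentical_upper_bound
    (t : Fin 2 → ℝ) (θ' θ'' : ℝ)
    (ht0 : 0 < t 0) (ht01 : t 0 ≤ t 1) (hθ0 : 0 < θ') (hθ : θ' ≤ θ'') :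
    (∀ (c : Fin 2 → ℕ), (∀ a, 1 ≤ c a) →
      ∀ (n : ℕ) (τ θ : Fin n → ℝ), ValidSeq τ → (∀ i, θ i = θ' ∨ θ i = θ'') →
        FeasibleInstance t c τ →
        ∀ g : Fin n → Fin 2, IsGreedy t c τ g →
          cost t θ g ≤
            (θ'' * t 1 + θ' * t 0) / (θ'' * t 0 + θ' * t 1) * OPT t c τ θ) ∧
    (∀ A : List (ℝ × ℝ) → Fin 2, FeasibleAlg t ![1, 1] A →
      ∃ (n : ℕ) (τ θ : Fin n → ℝ), ValidSeq τ ∧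
        (∀ i, θ i = θ' ∨ θ i = θ'') ∧
        FeasibleInstance t ![1, 1] τ ∧
        0 < OPT t ![1, 1] τ θ ∧
        (θ'' * t 1 + θ' * t 0) / (θ'' * t 0 + θ' * t 1) ≤
          cost t θ (algAssign A τ θ) / OPT t ![1, 1] τ θ) := by
  have hθ'' : 0 < θ'' := hθ0.trans_le hθ
  have hden : 0 < θ'' * t 0 + θ' * t 1 := by nlinarith
  have hc1 : ∀ a, 1 ≤ (![1, 1] : Fin 2 → ℕ) a := by simp [Fin.forall_fin_two]
  refine ⟨?_, ?_⟩
  · intro c _ n τ θ hτ hθi hfeas g hg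
    have hr : 0 < (θ'' * t 1 + θ' * t 0) / (θ'' * t 0 + θ' * t 1) :=
      div_pos (by nlinarith) hden
    obtain ⟨x₀, hx₀⟩ := hfeas
    rw [mul_comm, ← div_le_iff₀ hr]
    refine le_csInf ⟨_, x₀, hx₀, rfl⟩ ?_
    rintro _ ⟨x, hx, rfl⟩
    rw [div_le_iff₀ hr, mul_comm]
    refine cost_le_of_arcCount_le ht0 ht01 hθ0 hθ (fun i => ?_) ?_
    · rcases hθi i with h | h <;> simp [h, hθ]
    · exact card_filter_le_of_full hτ.1 ht0.le (hx 0) hg.le_loadBefore Finset.univ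
        (by simpa using isLowerSet_univ)
  · intro A hA
    by_cases hA0 : A [(0, θ')] = 0
    · have hval : ValidSeq ![0, t 0] := by
        refine ⟨?_, ?_⟩
        · rw [Fin.strictMono_iff_lt_succ]
          simpa using ht0
        · simp
      have hθpos : ∀ i, 0 < (![θ', θ''] : Fin 2 → ℝ) i := by
        simp [Fin.forall_fin_two, hθ0, hθ'']
      have hx : Feasible t ![1, 1] ![0, t 0] ![1, 0] :=
        feasible_of_injective hc1 (by decide)
      obtain ⟨hle, hpos⟩ := OPT_le_and_pos ht0 ht01 two_pos hθpos hx
      refine ⟨2, ![0, t 0], ![θ', θ''], hval, by simp [Fin.forall_fin_two], ⟨_, hx⟩, hpos, ?_⟩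
      have hfirst : algAssign A ![0, t 0] ![θ', θ''] 0 = 0 := by
        simpa [algAssign, hist] using hA0
      have hsecond : algAssign A ![0, t 0] ![θ', θ''] 1 = 1 := by
        by_contra hne
        have hzero : algAssign A ![0, t 0] ![θ', θ''] 1 = 0 := by omega
        have hload := hA 2 _ _ hval hθpos ⟨_, hx⟩ 0 1
        simp only [load, Matrix.cons_val_zero] at hload
        rw [Finset.card_le_one] at hload
        have := hload 0 (by simp [hfirst, ht0.le]) 1 (by simp [hzero, ht0.le])
        exact absurd this (by decide)
      refine div_le_div₀ ?_ ?_ hpos ?_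
      · unfold cost
        exact Finset.sum_nonneg fun i _ => mul_nonneg (hθpos i).le
          ((Fin.forall_fin_two (p := fun a => 0 ≤ t a)).mpr ⟨ht0.le, ht0.le.trans ht01⟩ _)
      · simp only [cost, Fin.sum_univ_two, hfirst, hsecond]
        simp [add_comm]
      · simpa [cost, add_comm] using hle
    · have hA1 : A [(0, θ')] = 1 := by omega
      have hval : ValidSeq (![0] : Fin 1 → ℝ) := ⟨Subsingleton.strictMono _, by simp⟩
      have hx : Feasible t ![1, 1] (![0] : Fin 1 → ℝ) ![0] :=
        feasible_of_injective hc1 (Function.injective_of_subsingleton _)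
      obtain ⟨hle, hpos⟩ :=
        OPT_le_and_pos (θ := ![θ']) ht0 ht01 one_pos (by simpa using hθ0) hx
      refine ⟨1, ![0], ![θ'], hval, by simp, ⟨_, hx⟩, hpos, ?_⟩
      have hcost : cost t ![θ'] (algAssign A ![0] ![θ']) = θ' * t 1 := by
        simp [cost, algAssign, hist, hA1]
      have hle' : OPT t ![1, 1] ![0] ![θ'] ≤ θ' * t 0 := by simpa [cost] using hle
      have ht1 : 0 < t 1 := ht0.trans_le ht01
      rw [hcost]
      refine le_trans ?_ (div_le_div_of_nonneg_left (by positivity) hpos hle')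
      rw [div_le_div_iff₀ hden (by positivity)]
      nlinarith [mul_nonneg (mul_pos hθ0 hθ0).le
        (mul_nonneg (sub_nonneg.mpr ht01) (add_pos ht0 ht1).le)]
end

section
/- Fix β ∈ (0,1) and integers K ≥ 1 and 0 ≤ k < K. The polynomial equation in t, C(K,k) t^{K−k} − (β/(2K)) ∑_{i=k}^{K−1} C(i,k) t^{i−k} − (β/(6K)) ∑_{i=K+1}^{4K} C(i,k) t^{i−k} = 0 (where C(m,k) denotes the binomial coefficient), has exactly two solutions in [0, ∞), denoted t̲(k) ≤ t̄(k). -/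
open Finset

noncomputable section

/-- The scenario-approach polynomial
`C(K,k) t^(K−k) − (β/(2K)) ∑_{i=k}^{K−1} C(i,k) t^(i−k)
  − (β/(6K)) ∑_{i=K+1}^{4K} C(i,k) t^(i−k)`. -/
def scenPoly (β : ℝ) (K k : ℕ) (s : ℝ) : ℝ :=
  (K.choose k : ℝ) * s ^ (K - k)
    - β / (2 * K) * ∑ i ∈ Finset.Icc k (K - 1), (i.choose k : ℝ) * s ^ (i - k)
    - β / (6 * K) * ∑ i ∈ Finset.Icc (K + 1) (4 * K), (i.choose k : ℝ) * s ^ (i - k)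

/-- A nonnegative combination of powers of `x` is convex on `(0, ∞)`. -/
theorem convexOn_sum_mul_zpow {ι : Type*} (A : Finset ι) (c : ι → ℝ) (e : ι → ℤ)
    (hc : ∀ i ∈ A, 0 ≤ c i) :
    ConvexOn ℝ (Set.Ioi (0 : ℝ)) fun x ↦ ∑ i ∈ A, c i * x ^ e i := by
  induction A using Finset.cons_induction with
  | empty => simpa using convexOn_const (0 : ℝ) (convex_Ioi (0 : ℝ))
  | cons a A ha ih =>
    simp only [Finset.sum_cons]
    exact ((convexOn_zpow (e a)).smul (hc a (Finset.mem_cons_self a A))).add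
      (ih fun i hi ↦ hc i (Finset.mem_cons_of_mem hi))

/-- A nonnegative combination of powers of `x`, in which some exponent other than `0` and `1`
has a positive coefficient, is strictly convex on `(0, ∞)`. -/
theorem strictConvexOn_sum_mul_zpow {ι : Type*} [DecidableEq ι] (A : Finset ι) (c : ι → ℝ)
    (e : ι → ℤ) (hc : ∀ i ∈ A, 0 ≤ c i) {a : ι} (ha : a ∈ A) (hca : 0 < c a) (h0 : e a ≠ 0)
    (h1 : e a ≠ 1) :
    StrictConvexOn ℝ (Set.Ioi (0 : ℝ)) fun x ↦ ∑ i ∈ A, c i * x ^ e i := by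
  have hz := strictConvexOn_zpow h0 h1
  have hs : StrictConvexOn ℝ (Set.Ioi (0 : ℝ)) fun x : ℝ ↦ c a * x ^ e a := by
    refine ⟨hz.1, fun x hx y hy hxy s t hs ht hst ↦ ?_⟩
    have := mul_lt_mul_of_pos_left (hz.2 hx hy hxy hs ht hst) hca
    simp only [smul_eq_mul] at this ⊢
    linarith
  have hr := convexOn_sum_mul_zpow (A.erase a) c e fun i hi ↦ hc i (Finset.mem_of_mem_erase hi)
  have := hs.add_convexOn hr
  refine this.congr fun x _ ↦ ?_
  exact Finset.add_sum_erase A (fun i ↦ c i * x ^ e i) ha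

/-- A strictly convex function on a subset of the line does not vanish at three distinct points. -/
theorem StrictConvexOn.not_three_zeros {s : Set ℝ} {g : ℝ → ℝ} (hg : StrictConvexOn ℝ s g)
    {x y z : ℝ} (hx : x ∈ s) (hz : z ∈ s) (hxy : x < y) (hyz : y < z)
    (gx : g x = 0) (gy : g y = 0) (gz : g z = 0) : False := by
  have := hg.slope_strict_mono_adjacent hx hz hxy hyz
  simp [gx, gy, gz] at this

/-- At the point `(K - k) / K` the terms `C(i,k) x ^ (i - k)` are largest for `i = K`. -/
theorem choose_mul_pow_le {K k : ℕ} (hk : k < K) {i : ℕ} (hi : k ≤ i) :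
    (i.choose k : ℝ) * (((K : ℝ) - k) / K) ^ (i - k)
      ≤ (K.choose k : ℝ) * (((K : ℝ) - k) / K) ^ (K - k) := by
  have hKk : (k : ℝ) < K := by exact_mod_cast hk
  have hk0 : (0 : ℝ) ≤ k := k.cast_nonneg
  have hK : (0 : ℝ) < K := hk0.trans_lt hKk
  set p : ℝ := ((K : ℝ) - k) / K with hp
  have hp0 : 0 < p := div_pos (by linarith) hK
  have hpK : p * K = K - k := by rw [hp]; field_simp
  have hrec : ∀ n : ℕ, k ≤ n →
      (n.choose k : ℝ) * (n + 1) = ((n + 1).choose k : ℝ) * ((n : ℝ) + 1 - k) := fun n hn ↦ by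
    have := Nat.choose_mul_succ_eq n k
    rw [← Nat.cast_inj (R := ℝ)] at this
    push_cast [Nat.cast_sub (hn.trans n.le_succ)] at this
    exact this
  have hpow : ∀ n : ℕ, k ≤ n → p ^ (n + 1 - k) = p * p ^ (n - k) := fun n hn ↦ by
    rw [Nat.succ_sub hn, pow_succ']
  rcases le_total K i with h | h
  · induction i, h using Nat.le_induction with
    | base => exact le_rfl
    | succ n hn ih =>
      have hkn := hk.le.trans hn
      refine le_trans ?_ (ih hkn)
      rw [hpow n hkn, ← mul_assoc]
      refine mul_le_mul_of_nonneg_right ?_ (by positivity)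
      have hKn : (K : ℝ) ≤ n := by exact_mod_cast hn
      have hpos : (0 : ℝ) < (n : ℝ) + 1 - k := by linarith
      refine le_of_mul_le_mul_right ?_ hpos
      calc ((n + 1).choose k : ℝ) * p * ((n : ℝ) + 1 - k)
          = (n.choose k : ℝ) * ((n + 1) * p) := by linear_combination -p * hrec n hkn
        _ ≤ (n.choose k : ℝ) * ((n : ℝ) + 1 - k) := by
          refine mul_le_mul_of_nonneg_left ?_ (Nat.cast_nonneg _)
          refine le_of_mul_le_mul_right ?_ hK
          nlinarith
  · induction h using Nat.decreasingInduction with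
    | self => exact le_rfl
    | of_succ n hn ih =>
      refine le_trans ?_ (ih (hi.trans n.le_succ))
      rw [hpow n hi, ← mul_assoc]
      refine mul_le_mul_of_nonneg_right ?_ (by positivity)
      have hKn : (n : ℝ) + 1 ≤ K := by exact_mod_cast hn
      have hkn : (k : ℝ) ≤ n := by exact_mod_cast hi
      have hpos : (0 : ℝ) < (n : ℝ) + 1 - k := by linarith
      refine le_of_mul_le_mul_right ?_ hpos
      calc (n.choose k : ℝ) * ((n : ℝ) + 1 - k)
          ≤ (n.choose k : ℝ) * ((n + 1) * p) := by
              refine mul_le_mul_of_nonneg_left ?_ (Nat.cast_nonneg _)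
              refine le_of_mul_le_mul_right ?_ hK
              nlinarith
        _ = ((n + 1).choose k : ℝ) * p * ((n : ℝ) + 1 - k) := by
          linear_combination p * hrec n hi

theorem continuous_scenPoly (β : ℝ) (K k : ℕ) : Continuous (scenPoly β K k) := by
  unfold scenPoly
  fun_prop

theorem one_le_sum_choose_mul_pow {K k : ℕ} (hk : k < K) {x : ℝ} (hx : 0 ≤ x) :
    1 ≤ ∑ i ∈ Finset.Icc k (K - 1), (i.choose k : ℝ) * x ^ (i - k) := by
  have := Finset.single_le_sum (f := fun i ↦ (i.choose k : ℝ) * x ^ (i - k))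
    (fun i _ ↦ by positivity) (Finset.mem_Icc.2 ⟨le_rfl, Nat.le_sub_one_of_lt hk⟩)
  simpa using this

theorem scenPoly_zero_neg {β : ℝ} (hβ : 0 < β) {K k : ℕ} (hk : k < K) :
    scenPoly β K k 0 < 0 := by
  have hK : (0 : ℝ) < K := by exact_mod_cast Nat.zero_lt_of_lt hk
  have h1 := mul_le_mul_of_nonneg_left (one_le_sum_choose_mul_pow hk le_rfl)
    (by positivity : 0 ≤ β / (2 * K))
  have h2 : 0 ≤ β / (6 * K) *
      ∑ i ∈ Finset.Icc (K + 1) (4 * K), (i.choose k : ℝ) * (0 : ℝ) ^ (i - k) := by positivity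
  have h3 : 0 < β / (2 * K) := by positivity
  have h4 : (0 : ℝ) ^ (K - k) = 0 := zero_pow (by omega)
  unfold scenPoly
  rw [h4]
  linarith

theorem scenPoly_pos {β : ℝ} (hβ : β ∈ Set.Ioo (0 : ℝ) 1) {K k : ℕ} (hk : k < K) :
    0 < scenPoly β K k (((K : ℝ) - k) / K) := by
  have hK : (0 : ℝ) < K := by exact_mod_cast Nat.zero_lt_of_lt hk
  have hKk : (k : ℝ) < K := by exact_mod_cast hk
  have hp0 : 0 < ((K : ℝ) - k) / K := div_pos (by linarith) hK
  have hβ0 := hβ.1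
  unfold scenPoly
  set p : ℝ := ((K : ℝ) - k) / K
  set M : ℝ := (K.choose k : ℝ) * p ^ (K - k) with hM
  have hM0 : 0 < M := mul_pos (by exact_mod_cast Nat.choose_pos hk.le) (by positivity)
  have h1 : ∑ i ∈ Finset.Icc k (K - 1), (i.choose k : ℝ) * p ^ (i - k) ≤ K * M := by
    refine (Finset.sum_le_card_nsmul _ _ M fun i hi ↦
      choose_mul_pow_le hk (Finset.mem_Icc.1 hi).1).trans ?_
    rw [nsmul_eq_mul, Nat.card_Icc]
    gcongr
    omega
  have h2 : ∑ i ∈ Finset.Icc (K + 1) (4 * K), (i.choose k : ℝ) * p ^ (i - k) ≤ 3 * K * M := by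
    refine (Finset.sum_le_card_nsmul _ _ M fun i hi ↦
      choose_mul_pow_le hk (by have := (Finset.mem_Icc.1 hi).1; omega)).trans ?_
    rw [nsmul_eq_mul, Nat.card_Icc, show 4 * K + 1 - (K + 1) = 3 * K by omega]
    push_cast
    exact le_rfl
  have h3 := mul_le_mul_of_nonneg_left h1 (by positivity : 0 ≤ β / (2 * K))
  have h4 := mul_le_mul_of_nonneg_left h2 (by positivity : 0 ≤ β / (6 * K))
  have h5 : β / (2 * K) * (K * M) = β * M / 2 := by field_simp
  have h6 : β / (6 * K) * (3 * K * M) = β * M / 2 := by field_simp; norm_num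
  have h7 := mul_lt_mul_of_pos_right hβ.2 hM0
  linarith

theorem scenPoly_neg {β : ℝ} (hβ : β ∈ Set.Ioo (0 : ℝ) 1) {K k : ℕ} (hk : k < K) :
    scenPoly β K k (6 * K / β) < 0 := by
  have hK1 : (1 : ℝ) ≤ K := by exact_mod_cast Nat.one_le_of_lt hk
  have hβ0 := hβ.1
  have hx1 : 1 ≤ 6 * K / β := by
    rw [le_div_iff₀ hβ0]
    linarith [hβ.2]
  have hinv : β / (6 * K) * (6 * K / β) = 1 := by field_simp
  unfold scenPoly
  set x : ℝ := 6 * K / β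
  have h1 := mul_le_mul_of_nonneg_left (one_le_sum_choose_mul_pow hk (by positivity : 0 ≤ x))
    (by positivity : 0 ≤ β / (2 * K))
  have h2 : ((4 * K).choose k : ℝ) * x ^ (4 * K - k)
      ≤ ∑ i ∈ Finset.Icc (K + 1) (4 * K), (i.choose k : ℝ) * x ^ (i - k) :=
    Finset.single_le_sum (f := fun i ↦ (i.choose k : ℝ) * x ^ (i - k))
      (fun i _ ↦ by positivity) (Finset.mem_Icc.2 ⟨by omega, le_rfl⟩)
  have h3 : (K.choose k : ℝ) * (x * x ^ (K - k)) ≤ ((4 * K).choose k : ℝ) * x ^ (4 * K - k) := by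
    rw [← pow_succ']
    gcongr
    · omega
    · omega
  have h4 := mul_le_mul_of_nonneg_left (h3.trans h2) (by positivity : 0 ≤ β / (6 * K))
  have h5 : β / (6 * K) * ((K.choose k : ℝ) * (x * x ^ (K - k)))
      = (K.choose k : ℝ) * x ^ (K - k) := by
    linear_combination (K.choose k : ℝ) * x ^ (K - k) * hinv
  have h6 : 0 < β / (2 * K) := by positivity
  linarith

/-- Up to sign, dividing the scenario polynomial by `x ^ (K - k)` gives a strictly convex
function on `(0, ∞)`. -/
theorem strictConvexOn_scenPoly {β : ℝ} (hβ : 0 < β) {K k : ℕ} (hk : k < K) :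
    StrictConvexOn ℝ (Set.Ioi (0 : ℝ)) fun x ↦ -(scenPoly β K k x / x ^ (K - k)) := by
  have hK : (0 : ℝ) < K := by exact_mod_cast Nat.zero_lt_of_lt hk
  have h1 := strictConvexOn_sum_mul_zpow (Finset.Icc k (K - 1))
    (fun i ↦ β / (2 * K) * (i.choose k : ℝ)) (fun i ↦ (i : ℤ) - K) (fun i _ ↦ by positivity)
    (Finset.mem_Icc.2 ⟨le_rfl, Nat.le_sub_one_of_lt hk⟩)
    (by simp only [Nat.choose_self]; positivity) (by omega) (by omega)
  have h2 := convexOn_sum_mul_zpow (Finset.Icc (K + 1) (4 * K))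
    (fun i ↦ β / (6 * K) * (i.choose k : ℝ)) (fun i ↦ (i : ℤ) - K) (fun i _ ↦ by positivity)
  refine ((h1.add_convexOn h2).add_const (-(K.choose k : ℝ))).congr fun x hx ↦ ?_
  have hx0 : x ≠ 0 := ne_of_gt hx
  have hterm : ∀ i : ℕ, k ≤ i → x ^ ((i : ℤ) - K) = x ^ (i - k) / x ^ (K - k) := fun i hi ↦ by
    rw [← zpow_natCast, ← zpow_natCast, ← zpow_sub₀ hx0]
    congr 1
    omega
  have e1 : ∑ i ∈ Finset.Icc k (K - 1), β / (2 * K) * (i.choose k : ℝ) * x ^ ((i : ℤ) - K)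
      = β / (2 * K) * (∑ i ∈ Finset.Icc k (K - 1), (i.choose k : ℝ) * x ^ (i - k))
        / x ^ (K - k) := by
    rw [Finset.mul_sum, Finset.sum_div]
    refine Finset.sum_congr rfl fun i hi ↦ ?_
    rw [hterm i (Finset.mem_Icc.1 hi).1]
    ring
  have e2 : ∑ i ∈ Finset.Icc (K + 1) (4 * K), β / (6 * K) * (i.choose k : ℝ) * x ^ ((i : ℤ) - K)
      = β / (6 * K) * (∑ i ∈ Finset.Icc (K + 1) (4 * K), (i.choose k : ℝ) * x ^ (i - k))
        / x ^ (K - k) := by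
    rw [Finset.mul_sum, Finset.sum_div]
    refine Finset.sum_congr rfl fun i hi ↦ ?_
    rw [hterm i (by have := (Finset.mem_Icc.1 hi).1; omega)]
    ring
  simp only [Pi.add_apply]
  rw [e1, e2, scenPoly]
  have := pow_ne_zero (K - k) hx0
  field_simp
  ring

/-- existence of exactly two nonnegative roots of the
scenario-approach polynomial, cf. Proposition 1.
For `β ∈ (0,1)`, `K ≥ 1` and `0 ≤ k < K`, the polynomial equation `scenPoly β K k t = 0`
has exactly two solutions `t̲(k) ≤ t̄(k)` in `[0, ∞)`: there are `tlo ≤ thi` in `[0, ∞)`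
such that the nonnegative solutions of the equation are precisely `tlo` and `thi`. -/
theorem stmt14_scenario_polynomial_two_roots
    (β : ℝ) (hβ : β ∈ Set.Ioo (0 : ℝ) 1) (K k : ℕ) (hK : 1 ≤ K) (hk : k < K) :
    ∃ tlo thi : ℝ, 0 ≤ tlo ∧ tlo ≤ thi ∧
      ∀ s : ℝ, 0 ≤ s → (scenPoly β K k s = 0 ↔ s = tlo ∨ s = thi) := by
  have hK0 : (0 : ℝ) < K := by exact_mod_cast hK
  have hKk : (k : ℝ) < K := by exact_mod_cast hk
  have hk0 : (0 : ℝ) ≤ k := k.cast_nonneg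
  have hβ0 := hβ.1
  have hneg0 := scenPoly_zero_neg hβ0 hk
  have hpos := scenPoly_pos hβ hk
  have hneg := scenPoly_neg hβ hk
  have hcont := continuous_scenPoly β K k
  have hconv := strictConvexOn_scenPoly hβ0 hk
  have hp0 : 0 ≤ ((K : ℝ) - k) / K := div_nonneg (by linarith) hK0.le
  have hpx : ((K : ℝ) - k) / K ≤ 6 * K / β := by
    have h1 : ((K : ℝ) - k) / K ≤ 1 := by rw [div_le_one hK0]; linarith
    have h2 : 1 ≤ 6 * K / β := by
      rw [le_div_iff₀ hβ0]
      have : (1 : ℝ) ≤ K := by exact_mod_cast hK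
      linarith [hβ.2]
    exact h1.trans h2
  obtain ⟨lo, hlo, hlo0⟩ := intermediate_value_Ioo hp0 hcont.continuousOn ⟨hneg0, hpos⟩
  obtain ⟨hi, hhi, hhi0⟩ := intermediate_value_Ioo' hpx hcont.continuousOn ⟨hneg, hpos⟩
  have hlohi : lo < hi := hlo.2.trans hhi.1
  refine ⟨lo, hi, hlo.1.le, hlohi.le, fun s hs ↦ ⟨fun h ↦ ?_, ?_⟩⟩
  · have hs0 : 0 < s := hs.lt_of_ne fun h0 ↦ by
      rw [← h0] at h
      exact hneg0.ne h
    have hhipos : 0 < hi := hlo.1.trans hlohi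
    by_contra! hne
    rcases lt_or_gt_of_ne hne.1 with h1 | h1
    · exact hconv.not_three_zeros hs0 hhipos h1 hlohi (by simp [h]) (by simp [hlo0])
        (by simp [hhi0])
    rcases lt_or_gt_of_ne hne.2 with h2 | h2
    · exact hconv.not_three_zeros hlo.1 hhipos h1 h2 (by simp [hlo0]) (by simp [h])
        (by simp [hhi0])
    · exact hconv.not_three_zeros hlo.1 hs0 hlohi h2 (by simp [hlo0]) (by simp [hhi0])
        (by simp [h])
  · rintro (rfl | rfl)
    · exact hlo0
    · exact hhi0

end
end
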